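/- arXiv:math/0006090 — 4 statements merged into one kernel-verified Lean document; each statement's English description precedes it below -/
import Mathlib

section
/- For all 1 ≤ i ≤ n−1 and m ≥ 1, P(i,m) = { ∑_{j=0}^{i} k_j λ_j : k_0,…,k_i ∈ ℤ_{≥0}, ∑_{j=0}^{i} k_j = m, k_i ≡ m (mod 2), and k_j ≡ 0 (mod 2) for all j ≠ i }, with the convention λ_0 = 0. -/
/- Statement 9: for `1 ≤ i ≤ n-1` and `m ≥ 1`, the type-`Cₙ` set `P(i,m)` equals
`{ ∑_{j=0}^{i} k_j λ_j : k_j ∈ ℤ_{≥0}, ∑ k_j = m, k_i ≡ m (mod 2), k_j even for j ≠ i }`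
(with `λ_0 = 0`). -/

open scoped Pointwise

namespace KRP9

variable (n : ℕ)

/-- The fundamental weight `λ_j` as element of `Λ = ℤⁿ` (1-based `j`, `λ_0 = 0`). -/
def lam (j : ℕ) : Fin n → ℤ := fun r => if (r : ℕ) + 1 = j then 1 else 0

/-- `P(i,2) = {2λ_j : 1 ≤ j ≤ i} ∪ {0}`. -/
def P2 (i : ℕ) : Set (Fin n → ℤ) := {x | ∃ j, 1 ≤ j ∧ j ≤ i ∧ x = 2 • lam n j} ∪ {0}

/-- `P(i,1) = {λ_i}`, `P(i,2)` as above, `P(i,m) = P(i,m-2) + P(i,2)` for `m ≥ 3`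
(and `P(i,0) = {0}`). -/
def P (i : ℕ) : ℕ → Set (Fin n → ℤ)
  | 0 => {0}
  | 1 => {lam n i}
  | 2 => P2 n i
  | m + 3 => P i (m + 1) + P2 n i

/-- The weights `∑_{j=0}^{i} k_j λ_j` with `∑ k_j = m`, `k_i ≡ m (mod 2)` and `k_j` even for
`j ≠ i`. -/
def parityWeights (i m : ℕ) : Set (Fin n → ℤ) :=
  {x | ∃ k : ℕ → ℕ,
      (∑ j ∈ Finset.range (i + 1), k j) = m ∧
      k i % 2 = m % 2 ∧
      (∀ j ≤ i, j ≠ i → k j % 2 = 0) ∧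
      x = ∑ j ∈ Finset.range (i + 1), k j • lam n j}

theorem lam_zero : lam n 0 = 0 := by
  ext r
  simp [lam]

theorem mem_P2_iff (i : ℕ) (x : Fin n → ℤ) : x ∈ P2 n i ↔ ∃ j ≤ i, x = 2 • lam n j := by
  constructor
  · rintro (⟨j, -, hj, rfl⟩ | rfl)
    · exact ⟨j, hj, rfl⟩
    · exact ⟨0, i.zero_le, by simp [lam_zero]⟩
  · rintro ⟨j, hj, rfl⟩
    rcases Nat.eq_zero_or_pos j with rfl | hpos
    · exact Or.inr (by simp [lam_zero])
    · exact Or.inl ⟨j, hpos, hj, rfl⟩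

theorem P_add_two (i m : ℕ) : P n i (m + 2) = P n i m + P2 n i := by
  cases m with
  | zero => simp [P]
  | succ m => rfl

theorem sum_add_single (k : ℕ → ℕ) {i j : ℕ} (hj : j ≤ i) (a : ℕ) :
    ∑ l ∈ Finset.range (i + 1), (k + Pi.single j a : ℕ → ℕ) l =
      ∑ l ∈ Finset.range (i + 1), k l + a := by
  simp [Finset.sum_add_distrib, hj]

theorem sum_add_single_smul_lam (k : ℕ → ℕ) {i j : ℕ} (hj : j ≤ i) (a : ℕ) :
    ∑ l ∈ Finset.range (i + 1), (k + Pi.single j a : ℕ → ℕ) l • lam n l =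
      ∑ l ∈ Finset.range (i + 1), k l • lam n l + a • lam n j := by
  simp only [Pi.add_apply, add_smul, Finset.sum_add_distrib]
  congr 1
  rw [Finset.sum_eq_single j]
  · simp
  · intro l _ hl
    simp [hl]
  · intro h
    exact absurd (Finset.mem_range.2 (Nat.lt_succ_of_le hj)) h

theorem add_single_two_mod (k : ℕ → ℕ) (j l : ℕ) :
    (k + Pi.single j 2 : ℕ → ℕ) l % 2 = k l % 2 := by
  by_cases h : l = j
  · subst h
    simp
  · simp [h]

theorem exists_two_le {k : ℕ → ℕ} {i m : ℕ}
    (hsum : ∑ j ∈ Finset.range (i + 1), k j = m + 2)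
    (heven : ∀ j ≤ i, j ≠ i → k j % 2 = 0) : ∃ j ≤ i, 2 ≤ k j := by
  by_contra! h
  have hzero : ∑ j ∈ Finset.range i, k j = 0 := by
    refine Finset.sum_eq_zero fun j hj => ?_
    have hji := Finset.mem_range.1 hj
    have := heven j hji.le hji.ne
    have := h j hji.le
    omega
  rw [Finset.sum_range_succ, hzero] at hsum
  have := h i le_rfl
  omega

theorem parityWeights_add_two (i m : ℕ) :
    parityWeights n i (m + 2) = parityWeights n i m + P2 n i := by
  ext x
  rw [Set.mem_add]
  constructor
  · rintro ⟨k, hsum, hi, heven, rfl⟩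
    obtain ⟨j, hj, hkj⟩ := exists_two_le hsum heven
    obtain ⟨k, rfl⟩ : ∃ k' : ℕ → ℕ, k = k' + Pi.single j 2 := by
      refine ⟨k - Pi.single j 2, funext fun l => ?_⟩
      by_cases h : l = j
      · subst h
        simp [hkj]
      · simp [h]
    rw [sum_add_single k hj] at hsum
    simp only [add_single_two_mod] at hi heven
    exact ⟨_, ⟨k, by omega, by omega, heven, rfl⟩, _, (mem_P2_iff n i _).2 ⟨j, hj, rfl⟩,
      (sum_add_single_smul_lam n k hj 2).symm⟩
  · rintro ⟨_, ⟨k, hsum, hi, heven, rfl⟩, y, hy, rfl⟩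
    obtain ⟨j, hj, rfl⟩ := (mem_P2_iff n i y).1 hy
    refine ⟨k + Pi.single j 2, ?_, ?_, ?_, (sum_add_single_smul_lam n k hj 2).symm⟩
    · rw [sum_add_single k hj, hsum]
    · rw [add_single_two_mod]
      omega
    · intro l
      rw [add_single_two_mod]
      exact heven l

theorem parityWeights_zero (i : ℕ) : parityWeights n i 0 = {0} := by
  ext x
  rw [Set.mem_singleton_iff]
  constructor
  · rintro ⟨k, hsum, -, -, rfl⟩
    rw [Finset.sum_eq_zero_iff] at hsum
    exact Finset.sum_eq_zero fun j hj => by rw [hsum j hj, zero_smul]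
  · rintro rfl
    exact ⟨0, by simp⟩

theorem parityWeights_one (i : ℕ) : parityWeights n i 1 = {lam n i} := by
  ext x
  rw [Set.mem_singleton_iff]
  constructor
  · rintro ⟨k, hsum, hi, -, rfl⟩
    rw [Finset.sum_range_succ] at hsum
    have hki : k i = 1 := by omega
    have hzero : ∑ j ∈ Finset.range i, k j = 0 := by omega
    rw [Finset.sum_eq_zero_iff] at hzero
    rw [Finset.sum_range_succ, hki, one_smul, Finset.sum_eq_zero, zero_add]
    exact fun j hj => by rw [hzero j hj, zero_smul]
  · rintro rfl
    refine ⟨0 + Pi.single i 1, ?_, by simp, fun j _ hj => by simp [hj], ?_⟩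
    · rw [sum_add_single 0 le_rfl]
      simp
    · rw [sum_add_single_smul_lam n 0 le_rfl]
      simp

theorem P_eq_parityWeights (i m : ℕ) : P n i m = parityWeights n i m := by
  induction m using Nat.twoStepInduction with
  | zero => rw [parityWeights_zero, P]
  | one => rw [parityWeights_one, P]
  | more m ih _ => rw [P_add_two, parityWeights_add_two, ih]

theorem statement_9 (hn : 2 ≤ n) (i m : ℕ) (hi1 : 1 ≤ i) (hin : i ≤ n - 1) (hm : 1 ≤ m) :
    P n i m = {x | ∃ k : ℕ → ℕ,
      (∑ j ∈ Finset.range (i + 1), k j) = m ∧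
      k i % 2 = m % 2 ∧
      (∀ j ≤ i, j ≠ i → k j % 2 = 0) ∧
      x = ∑ j ∈ Finset.range (i + 1), k j • lam n j} := by
  exact P_eq_parityWeights n i m

end KRP9
end

section
/- Fix 1 ≤ i ≤ n−1 and m ≥ 1. The map sending a tuple s = (s_1,…,s_i) ∈ ℤ^i with 0 ≤ s_1 ≤ s_2 ≤ ⋯ ≤ s_i and 2s_i ≤ m to the element μ_s = (m − 2s_i)·λ_i + ∑_{j=1}^{i−1} 2(s_{j+1} − s_j)·λ_j of Λ is injective, and its image is exactly P(i,m). -/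
/- Statement 14: for `1 ≤ i ≤ n-1`, `m ≥ 1`, the assignment
`s = (s_1 ≤ ⋯ ≤ s_i)` (with `2s_i ≤ m`) `↦ μ_s = (m-2s_i)λ_i + ∑_{j=1}^{i-1} 2(s_{j+1}-s_j)λ_j`
is injective with image exactly the type-`Cₙ` set `P(i,m)`. -/

open scoped Pointwise

namespace KRP14

variable (n : ℕ)

/-- The fundamental weight `λ_j` as element of `Λ = ℤⁿ` (1-based `j`, `λ_0 = 0`). -/
def lam (j : ℕ) : Fin n → ℤ := fun r => if (r : ℕ) + 1 = j then 1 else 0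

/-- `P(i,2) = {2λ_j : 1 ≤ j ≤ i} ∪ {0}`. -/
def P2 (i : ℕ) : Set (Fin n → ℤ) := {x | ∃ j, 1 ≤ j ∧ j ≤ i ∧ x = 2 • lam n j} ∪ {0}

/-- `P(i,1) = {λ_i}`, `P(i,2)` as above, `P(i,m) = P(i,m-2) + P(i,2)` for `m ≥ 3`
(and `P(i,0) = {0}`). -/
def P (i : ℕ) : ℕ → Set (Fin n → ℤ)
  | 0 => {0}
  | 1 => {lam n i}
  | 2 => P2 n i
  | m + 3 => P i (m + 1) + P2 n i

/-- `μ_s = (m - 2s_i)·λ_i + ∑_{j=1}^{i-1} 2(s_{j+1} - s_j)·λ_j` (1-based indices). -/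
def mu (i m : ℕ) (s : ℕ → ℕ) : Fin n → ℤ :=
  (m - 2 * s i) • lam n i + ∑ j ∈ Finset.Ico 1 i, (2 * (s (j + 1) - s j)) • lam n j

/-- Coordinates of `μ_s`. -/
lemma mu_apply (i m : ℕ) (s : ℕ → ℕ) (r : Fin n) :
    mu n i m s r = if (r : ℕ) + 1 = i then ((m - 2 * s i : ℕ) : ℤ)
      else if (r : ℕ) + 1 < i then ((2 * (s (r + 2) - s (r + 1)) : ℕ) : ℤ) else 0 := by
  have hsum : (∑ j ∈ Finset.Ico 1 i, (2 * (s (j + 1) - s j)) • lam n j) r =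
      if (r : ℕ) + 1 < i then ((2 * (s (r + 2) - s (r + 1)) : ℕ) : ℤ) else 0 := by
    rw [Finset.sum_apply]
    simp only [Pi.smul_apply, lam, nsmul_eq_mul, mul_ite, mul_one, mul_zero]
    rw [Finset.sum_ite_eq]
    simp
  unfold mu
  rw [Pi.add_apply, hsum]
  simp only [Pi.smul_apply, lam, nsmul_eq_mul, mul_ite, mul_one, mul_zero]
  split_ifs <;> omega

/-- Raising by one all the entries of `s` of index greater than `j`, and `m` by two, adds `2λ_j`. -/
lemma mu_add_two (i m j : ℕ) (s t : ℕ → ℕ) (hi1 : 1 ≤ i) (hj : j ≤ i)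
    (hs : ∀ k, 1 ≤ k → k < i → s k ≤ s (k + 1)) (hsm : 2 * s i ≤ m)
    (ht : ∀ k, 1 ≤ k → k ≤ i → t k = s k + if j < k then 1 else 0) :
    mu n i (m + 2) t = mu n i m s + 2 • lam n j := by
  ext r
  rw [Pi.add_apply, mu_apply n i, mu_apply n i]
  simp only [Pi.smul_apply, lam, nsmul_eq_mul, Nat.cast_ofNat]
  have hti := ht i hi1 le_rfl
  by_cases h : (r : ℕ) + 1 < i
  · have h1 := ht (r + 1) (by omega) h.le
    have h2 := ht (r + 2) (by omega) h
    have h3 : s (r + 1) ≤ s (r + 2) := hs (r + 1) (by omega) h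
    rw [if_neg h.ne, if_pos h, if_neg h.ne, if_pos h, h1, h2]
    split_ifs <;> omega
  · rw [if_neg h, if_neg h, hti]
    split_ifs <;> omega

lemma lam_zero : lam n 0 = 0 := by
  ext r
  simp [lam]

lemma mem_P2_iff (i : ℕ) (x : Fin n → ℤ) : x ∈ P2 n i ↔ ∃ j ≤ i, x = 2 • lam n j := by
  constructor
  · rintro (⟨j, -, hj, rfl⟩ | rfl)
    · exact ⟨j, hj, rfl⟩
    · exact ⟨0, i.zero_le, by simp [lam_zero]⟩
  · rintro ⟨j, hj, rfl⟩
    rcases Nat.eq_zero_or_pos j with rfl | h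
    · exact Or.inr (by simp [lam_zero])
    · exact Or.inl ⟨j, h, hj, rfl⟩

lemma P_add_two (i m : ℕ) : P n i (m + 2) = P n i m + P2 n i := by
  cases m with
  | zero => simp [P]
  | succ m => rfl

/-- The zeros of a monotone sequence form an initial segment. -/
lemma exists_zero_initial_segment (i : ℕ) (s : ℕ → ℕ)
    (hs : ∀ k, 1 ≤ k → k < i → s k ≤ s (k + 1)) :
    ∃ j ≤ i, ∀ k, 1 ≤ k → k ≤ i → (j < k ↔ 1 ≤ s k) := by
  induction i with
  | zero => exact ⟨0, le_rfl, fun k _ _ => by omega⟩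
  | succ i ih =>
    obtain ⟨j, hj, h⟩ := ih fun k h1 h2 => hs k h1 (by omega)
    by_cases h0 : s (i + 1) = 0
    · refine ⟨i + 1, le_rfl, ?_⟩
      have hzero : ∀ d k, 1 ≤ k → k + d = i + 1 → s k = 0 := by
        intro d
        induction d with
        | zero =>
          rintro k - rfl
          exact h0
        | succ d ihd =>
          intro k h1 h2
          have := ihd (k + 1) (by omega) (by omega)
          have := hs k h1 (by omega)
          omega
      intro k h1 h2
      have := hzero (i + 1 - k) k h1 (by omega)
      omega
    · refine ⟨j, by omega, fun k h1 h2 => ?_⟩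
      rcases h2.eq_or_lt with rfl | h3
      · omega
      · exact h k h1 (by omega)

lemma mu_injective (i m : ℕ) (hi1 : 1 ≤ i) (hin : i ≤ n) (s t : ℕ → ℕ)
    (hs : ∀ j, 1 ≤ j → j < i → s j ≤ s (j + 1)) (hsm : 2 * s i ≤ m)
    (ht : ∀ j, 1 ≤ j → j < i → t j ≤ t (j + 1)) (htm : 2 * t i ≤ m)
    (h : mu n i m s = mu n i m t) (j : ℕ) (hj1 : 1 ≤ j) (hji : j ≤ i) : s j = t j := by
  have hcoord : ∀ k (hk : k < n), mu n i m s ⟨k, hk⟩ = mu n i m t ⟨k, hk⟩ := by simp [h]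
  simp only [mu_apply n i m] at hcoord
  induction hji using Nat.decreasingInduction with
  | self =>
    have := hcoord (i - 1) (by omega)
    rw [if_pos (by omega), if_pos (by omega)] at this
    omega
  | of_succ k hk ih =>
    have hsucc := ih (by omega)
    have := hcoord (k - 1) (by omega)
    rw [if_neg (by omega), if_pos (by omega), if_neg (by omega), if_pos (by omega),
      show k - 1 + 2 = k + 1 by omega, show k - 1 + 1 = k by omega] at this
    have := hs k hj1 hk
    have := ht k hj1 hk
    omega

lemma mem_P_iff (i : ℕ) (hi1 : 1 ≤ i) (m : ℕ) (x : Fin n → ℤ) :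
    x ∈ P n i m ↔ ∃ s : ℕ → ℕ,
      (∀ j, 1 ≤ j → j < i → s j ≤ s (j + 1)) ∧ 2 * s i ≤ m ∧ x = mu n i m s := by
  have hvanish : ∀ s : ℕ → ℕ, (∀ j, 1 ≤ j → j < i → s j ≤ s (j + 1)) → s i = 0 →
      ∀ m, mu n i m s = m • lam n i := by
    intro s hs h0 m
    obtain ⟨j, hj, h⟩ := exists_zero_initial_segment i s hs
    have hij := h i hi1 le_rfl
    unfold mu
    rw [Finset.sum_eq_zero, h0, mul_zero, Nat.sub_zero, add_zero]
    intro k hk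
    rw [Finset.mem_Ico] at hk
    have := h (k + 1) (by omega) (by omega)
    rw [show s (k + 1) = 0 by omega]
    simp
  induction m using Nat.twoStepInduction generalizing x with
  | zero =>
    constructor
    · rintro rfl
      exact ⟨0, by simp, by simp, by simp [hvanish 0]⟩
    · rintro ⟨s, hs, hsm, rfl⟩
      rw [hvanish s hs (by omega)]
      simp [P]
  | one =>
    constructor
    · rintro rfl
      exact ⟨0, by simp, by simp, by simp [hvanish 0]⟩
    · rintro ⟨s, hs, hsm, rfl⟩
      rw [hvanish s hs (by omega)]
      simp [P]
  | more m ih _ =>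
    rw [P_add_two, Set.mem_add]
    constructor
    · rintro ⟨y, hy, z, hz, rfl⟩
      obtain ⟨s, hs, hsm, rfl⟩ := (ih y).1 hy
      obtain ⟨j, hj, rfl⟩ := (mem_P2_iff n i z).1 hz
      refine ⟨fun k => s k + if j < k then 1 else 0, ?_, ?_, ?_⟩
      · intro k h1 h2
        have := hs k h1 h2
        dsimp only
        split_ifs <;> omega
      · dsimp only
        split_ifs <;> omega
      · exact (mu_add_two n i m j s _ hi1 hj hs hsm fun _ _ _ => rfl).symm
    · rintro ⟨t, ht, htm, rfl⟩
      obtain ⟨j, hj, h⟩ := exists_zero_initial_segment i t ht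
      have hs : ∀ k, 1 ≤ k → k < i → t k - 1 ≤ t (k + 1) - 1 :=
        fun k h1 h2 => Nat.sub_le_sub_right (ht k h1 h2) 1
      have hsm : 2 * (t i - 1) ≤ m := by omega
      refine ⟨_, (ih _).2 ⟨fun k => t k - 1, hs, hsm, rfl⟩, _,
        (mem_P2_iff n i _).2 ⟨j, hj, rfl⟩, ?_⟩
      refine (mu_add_two n i m j _ t hi1 hj hs hsm fun k h1 h2 => ?_).symm
      have := h k h1 h2
      split_ifs <;> omega

theorem statement_14 (hn : 2 ≤ n) (i m : ℕ) (hi1 : 1 ≤ i) (hin : i ≤ n - 1) (hm : 1 ≤ m) :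
    (∀ s t : ℕ → ℕ,
      (∀ j, 1 ≤ j → j < i → s j ≤ s (j + 1)) → 2 * s i ≤ m →
      (∀ j, 1 ≤ j → j < i → t j ≤ t (j + 1)) → 2 * t i ≤ m →
      mu n i m s = mu n i m t → ∀ j, 1 ≤ j → j ≤ i → s j = t j) ∧
    P n i m = {x | ∃ s : ℕ → ℕ,
      (∀ j, 1 ≤ j → j < i → s j ≤ s (j + 1)) ∧ 2 * s i ≤ m ∧ x = mu n i m s} := by
  refine ⟨fun s t hs hsm ht htm h => mu_injective n i m hi1 (by omega) s t hs hsm ht htm h, ?_⟩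
  ext x
  exact mem_P_iff n i hi1 m x

end KRP14
end

section
/- Let 1 ≤ i ≤ n, m ≥ 1, and μ ∈ P(i,m). Then ℓ(μ) ≤ m, and μ + λ_2 ∈ P(i,m) if and only if ℓ(μ) < m. -/
/- Statement 15: for `1 ≤ i ≤ n`, `m ≥ 1` and `μ ∈ P(i,m)` (type `Bₙ`/`Dₙ` sets),
one has `ℓ(μ) ≤ m`, and `μ + λ_2 ∈ P(i,m)` iff `ℓ(μ) < m`. -/

open scoped Pointwise

namespace KRP15

variable (n : ℕ)

/-- The fundamental weight `λ_j` as element of `Λ = ℤⁿ` (1-based `j`, `λ_0 = 0`). -/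
def lam (j : ℕ) : Fin n → ℤ := fun r => if (r : ℕ) + 1 = j then 1 else 0

/-- `P(i,1) = {λ_{i-2j} : 0 ≤ j ≤ ⌊i/2⌋}`. -/
def P1 (i : ℕ) : Set (Fin n → ℤ) := {x | ∃ j, j ≤ i / 2 ∧ x = lam n (i - 2 * j)}

/-- `P(i,1)` as above and `P(i,m) = P(i,1) + P(i,m-1)` for `m ≥ 2` (and `P(i,0) = {0}`). -/
def P (i : ℕ) : ℕ → Set (Fin n → ℤ)
  | 0 => {0}
  | 1 => P1 n i
  | m + 2 => P1 n i + P i (m + 1)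

/-- `ℓ(μ) = ∑_r k_r` for `μ = ∑_r k_r λ_r`. -/
def ell (x : Fin n → ℤ) : ℤ := ∑ r, x r

theorem P_succ (i m : ℕ) : P n i (m + 1) = P1 n i + P n i m := by
  cases m with
  | zero => simp [P]
  | succ m => rfl

theorem ell_add (x y : Fin n → ℤ) : ell n (x + y) = ell n x + ell n y := by
  simp [ell, Finset.sum_add_distrib]

theorem lam_zero : lam n 0 = 0 := by
  funext r
  simp [lam]

theorem ell_lam {j : ℕ} (hj1 : 1 ≤ j) (hjn : j ≤ n) : ell n (lam n j) = 1 := by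
  unfold ell lam
  rw [Finset.sum_eq_single (⟨j - 1, by omega⟩ : Fin n)]
  · simp only [ite_eq_left_iff]
    omega
  · intro r _ hr
    have : (r : ℕ) ≠ j - 1 := fun h => hr (Fin.ext h)
    rw [if_neg (by omega)]
  · simp

/-- An element of `P(i,1)` has length one, unless `i` is even and the element is zero. -/
theorem ell_eq_one_or_eq_zero {i : ℕ} (hin : i ≤ n) {x : Fin n → ℤ} (hx : x ∈ P1 n i) :
    ell n x = 1 ∨ (x = 0 ∧ Even i) := by
  obtain ⟨j, hj, rfl⟩ := hx
  rcases Nat.eq_zero_or_pos (i - 2 * j) with h | h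
  · exact Or.inr ⟨by rw [h, lam_zero], ⟨j, by omega⟩⟩
  · exact Or.inl (ell_lam n h (by omega))

theorem ell_le_of_mem_P {i : ℕ} (hin : i ≤ n) (m : ℕ) {μ : Fin n → ℤ} (hμ : μ ∈ P n i m) :
    ell n μ ≤ m := by
  induction m generalizing μ with
  | zero =>
    obtain rfl : μ = 0 := hμ
    simp [ell]
  | succ m ih =>
    rw [P_succ] at hμ
    obtain ⟨a, ha, b, hb, rfl⟩ := hμ
    have hb' := ih hb
    have ha' : ell n a ≤ 1 := by
      rcases ell_eq_one_or_eq_zero n hin ha with h | ⟨rfl, -⟩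
      · exact h.le
      · simp [ell]
    have := ell_add n a b
    push_cast
    linarith

theorem add_lam_two_mem_P {i : ℕ} (hi1 : 1 ≤ i) (hin : i ≤ n) (m : ℕ) {μ : Fin n → ℤ}
    (hμ : μ ∈ P n i m) (hlt : ell n μ < m) : μ + lam n 2 ∈ P n i m := by
  induction m generalizing μ with
  | zero =>
    obtain rfl : μ = 0 := hμ
    simp [ell] at hlt
  | succ m ih =>
    rw [P_succ] at hμ ⊢
    obtain ⟨a, ha, b, hb, rfl⟩ := hμ
    rcases ell_eq_one_or_eq_zero n hin ha with h | ⟨rfl, k, hk⟩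
    · refine ⟨a, ha, b + lam n 2, ih hb ?_, (add_assoc a b _).symm⟩
      have := ell_add n a b
      push_cast at hlt
      linarith
    · refine ⟨lam n 2, ⟨k - 1, by omega, ?_⟩, b, hb, ?_⟩
      · congr 1
        omega
      · simp [add_comm]

theorem statement_15 (hn : 2 ≤ n) (i m : ℕ) (hi1 : 1 ≤ i) (hin : i ≤ n) (hm : 1 ≤ m)
    (μ : Fin n → ℤ) (hμ : μ ∈ P n i m) :
    ell n μ ≤ (m : ℤ) ∧ (μ + lam n 2 ∈ P n i m ↔ ell n μ < (m : ℤ)) := by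
  refine ⟨ell_le_of_mem_P n hin m hμ, fun h => ?_, add_lam_two_mem_P n hi1 hin m hμ⟩
  have h' := ell_le_of_mem_P n hin m h
  rw [ell_add, ell_lam n one_le_two hn] at h'
  linarith

end KRP15
end

section
/- Let 0 ≤ j < i ≤ n−1. Define c ∈ ℤⁿ by c_r = 2(r−j) for j+1 ≤ r ≤ i, c_r = 2(i−j) for i+1 ≤ r ≤ n−1, c_n = i−j, and c_r = 0 for 1 ≤ r ≤ j. Then every c_r ∈ ℤ_{≥0}, c_r = 0 for r ≤ j, and for every 1 ≤ k ≤ n, ∑_{r=1}^{n} c_r · a_{rk} equals 2 if k = i, equals −2 if k = j, and equals 0 otherwise. In particular, in type C_n the element 2λ_i − 2λ_j (with λ_0 = 0) is a ℤ_{≥0}-linear combination of the simple roots α_{j+1},…,α_n. -/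
/- Statement 16: in type `Cₙ`, for `0 ≤ j < i ≤ n-1`, the explicitly given vector `c`
is a nonnegative combination supported on `α_{j+1}, …, α_n` whose fundamental-weight
coordinates are those of `2λ_i - 2λ_j` (with `λ_0 = 0`). -/

namespace KRcartan16

variable (n : ℕ)

/-- The Cartan matrix of type `Cₙ` (1-based indices). -/
def A (r k : ℕ) : ℤ :=
  if r = k then 2
  else if k = r + 1 ∧ 1 ≤ r ∧ r ≤ n - 1 then -1
  else if r = k + 1 ∧ 1 ≤ k ∧ k ≤ n - 2 then -1
  else if r = n ∧ k = n - 1 then -2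
  else 0

/-- The coefficient vector: `c_r = 2(r-j)` for `j+1 ≤ r ≤ i`, `c_r = 2(i-j)` for
`i+1 ≤ r ≤ n-1`, `c_n = i-j`, and `c_r = 0` for `r ≤ j`. -/
def c (i j r : ℕ) : ℤ :=
  if r ≤ j then 0
  else if r ≤ i then 2 * ((r : ℤ) - (j : ℤ))
  else if r ≤ n - 1 then 2 * ((i : ℤ) - (j : ℤ))
  else (i : ℤ) - (j : ℤ)

/-- The fundamental weight `λ_j` in fundamental-weight coordinates (1-based `j`,
`λ_0 = 0`). -/
def lam (j : ℕ) : Fin n → ℤ := fun t => if (t : ℕ) + 1 = j then 1 else 0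

theorem sum_mul_A (f : ℕ → ℤ) (hf : f 0 = 0) {k : ℕ} (hk : 1 ≤ k) (hkn : k ≤ n) :
    ∑ r ∈ Finset.Icc 1 n, f r * A n r k
      = 2 * f k - f (k - 1)
        - (if k = n then 0 else if k + 1 = n then 2 * f n else f (k + 1)) := by
  have key : ∀ r ∈ Finset.Icc 1 n, f r * A n r k
      = (if r = k then 2 * f r else 0) - (if r = k - 1 then f r else 0)
        - (if r = k + 1 then (if k + 1 = n then 2 * f r else f r) else 0) := by
    intro r hr
    rw [Finset.mem_Icc] at hr
    unfold A
    split_ifs <;> omega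
  rw [Finset.sum_congr rfl key, Finset.sum_sub_distrib, Finset.sum_sub_distrib,
    Finset.sum_ite_eq', Finset.sum_ite_eq', Finset.sum_ite_eq']
  simp only [Finset.mem_Icc]
  obtain rfl | h1 := eq_or_lt_of_le hk
  · simp only [Nat.sub_self, hf]
    split_ifs <;> grind
  · split_ifs <;> grind

theorem c_nonneg {i j : ℕ} (hj : j < i) (r : ℕ) : 0 ≤ c n i j r := by
  unfold c
  split_ifs <;> omega

theorem c_eq_zero {i j r : ℕ} (hr : r ≤ j) : c n i j r = 0 := if_pos hr

theorem sum_c_mul_A {i j k : ℕ} (hj : j < i) (hi : i ≤ n - 1) (hk : 1 ≤ k) (hkn : k ≤ n) :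
    ∑ r ∈ Finset.Icc 1 n, c n i j r * A n r k
      = if k = i then 2 else if k = j then -2 else 0 := by
  rw [sum_mul_A n _ (c_eq_zero n j.zero_le) hk hkn]
  obtain h | h | h | h | h : k < j ∨ k = j ∨ (j < k ∧ k < i) ∨ k = i ∨ i < k := by omega
  all_goals
    obtain hn | hn | hn : k = n ∨ k + 1 = n ∨ k + 1 < n := by omega
    all_goals grind [c]

theorem statement_16 (hn : 2 ≤ n) (i j : ℕ) (hj : j < i) (hi : i ≤ n - 1) :
    (∀ r, 1 ≤ r → r ≤ n → 0 ≤ c n i j r) ∧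
    (∀ r, r ≤ j → c n i j r = 0) ∧
    (∀ k, 1 ≤ k → k ≤ n →
      (∑ r ∈ Finset.Icc 1 n, c n i j r * A n r k)
        = if k = i then 2 else if k = j then -2 else 0) ∧
    (∃ d : ℕ → ℕ, (∀ r, r ≤ j → d r = 0) ∧
      (2 • lam n i - 2 • lam n j)
        = fun t : Fin n => ∑ r ∈ Finset.Icc 1 n, (d r : ℤ) * A n r ((t : ℕ) + 1)) := by
  refine ⟨fun r _ _ => c_nonneg n hj r, fun r hr => c_eq_zero n hr,
    fun k hk hkn => sum_c_mul_A n hj hi hk hkn,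
    fun r => (c n i j r).toNat, fun r hr => by simp [c_eq_zero n hr], ?_⟩
  funext t
  simp only [Int.toNat_of_nonneg (c_nonneg n hj _)]
  rw [sum_c_mul_A n hj hi (by omega) (by omega)]
  rw [Pi.sub_apply, Pi.smul_apply, Pi.smul_apply, nsmul_eq_mul, nsmul_eq_mul]
  unfold lam
  split_ifs <;> omega

end KRcartan16
end
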